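/- arXiv:math/0409233 — 2 statements merged into one kernel-verified Lean document; each statement's English description precedes it below -/
import Mathlib

section
/- Let (W_i)_{i≥1} be an unbounded admissible Fibonacci sequence in 𝒫 for which there exist constants c > 0 and C > 0 such that ‖W_{i+2}‖ ≥ c·‖W_{i+1}‖·‖W_i‖ and |det W_i| ≤ C for all i ≥ 1. Then there exists an extremal real number ξ such that (W_i)_{i≥1} is associated to ξ. -/
open Matrix

/-- 2×2 integer matrices. -/
abbrev M2 : Type := Matrix (Fin 2) (Fin 2) ℤ

/-- The content of an integer matrix: the gcd of its coefficients. -/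
def content (A : M2) : ℕ :=
  Nat.gcd (Nat.gcd (A 0 0).natAbs (A 0 1).natAbs) (Nat.gcd (A 1 0).natAbs (A 1 1).natAbs)

/-- A matrix is primitive if its content is 1. -/
def Primitive (A : M2) : Prop := content A = 1

/-- Membership in 𝒫: primitive with nonzero determinant. -/
def MemP (A : M2) : Prop := Primitive A ∧ A.det ≠ 0

/-- `A^red`: the primitive matrix such that `A = content A • A^red`. -/
def red (A : M2) : M2 := Matrix.of fun i j => A i j / (content A : ℤ)

/-- The group operation of 𝒫: `A * B = (AB)^red`. -/
def pmul (A B : M2) : M2 := red (A * B)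

/-- A Fibonacci sequence in 𝒫 (indices from 1). -/
def IsFibP (W : ℕ → M2) : Prop :=
  (∀ i, 1 ≤ i → MemP (W i)) ∧ ∀ i, 1 ≤ i → W (i + 2) = pmul (W (i + 1)) (W i)

/-- Admissibility of a Fibonacci sequence in 𝒫: there is a non-symmetric,
non-skew-symmetric N ∈ 𝒫 such that W_i N_i is symmetric for all i ≥ 1,
where N_i = ᵗN for odd i and N_i = N for even i. -/
def AdmissibleFib (W : ℕ → M2) : Prop :=
  ∃ N : M2, MemP N ∧ N ≠ Nᵀ ∧ N ≠ -Nᵀ ∧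
    ∀ i, 1 ≤ i → (W i * (if i % 2 = 1 then Nᵀ else N)).IsSymm

/-- The norm of an integer 2×2 matrix: max absolute value of coefficients, as a real. -/
noncomputable def mnorm (A : M2) : ℝ :=
  max (max |(A 0 0 : ℝ)| |(A 0 1 : ℝ)|) (max |(A 1 0 : ℝ)| |(A 1 1 : ℝ)|)

/-- The sequence is unbounded in norm. -/
def UnboundedSeq (W : ℕ → M2) : Prop := ∀ C : ℝ, ∃ i, 1 ≤ i ∧ C < mnorm (W i)

/-- The golden ratio γ = (1+√5)/2. -/
noncomputable def gam : ℝ := (1 + Real.sqrt 5) / 2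

/-- Norm of the row vector (ξ, -1)·A. -/
noncomputable def xiNorm (ξ : ℝ) (A : M2) : ℝ :=
  max |ξ * (A 0 0 : ℝ) - (A 1 0 : ℝ)| |ξ * (A 0 1 : ℝ) - (A 1 1 : ℝ)|

/-- ξ is extremal: neither rational nor quadratic over ℚ, and for each X ≥ 1 the system
|x₀| ≤ X, |x₀ξ - x₁| ≤ c X^(-1/γ), |x₀ξ² - x₂| ≤ c X^(-1/γ) has a nonzero integer solution. -/
def IsExtremal (ξ : ℝ) : Prop :=
  (∀ a b c : ℚ, ¬(a = 0 ∧ b = 0 ∧ c = 0) → (a : ℝ) * ξ ^ 2 + (b : ℝ) * ξ + (c : ℝ) ≠ 0) ∧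
  ∃ c : ℝ, 0 < c ∧ ∀ X : ℝ, 1 ≤ X → ∃ x₀ x₁ x₂ : ℤ,
    ¬(x₀ = 0 ∧ x₁ = 0 ∧ x₂ = 0) ∧ |(x₀ : ℝ)| ≤ X ∧
    |(x₀ : ℝ) * ξ - (x₁ : ℝ)| ≤ c * X ^ (-1 / gam) ∧
    |(x₀ : ℝ) * ξ ^ 2 - (x₂ : ℝ)| ≤ c * X ^ (-1 / gam)

/-- The Fibonacci sequence `W` in 𝒫 is associated to the extremal real number ξ:
it is an unbounded admissible Fibonacci sequence in 𝒫 with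
‖W_{i+1}‖ ≍ ‖W_i‖^γ, ‖(ξ,-1)W_i‖ ≍ ‖W_i‖⁻¹ and |det W_i| ≍ 1. -/
def IsAssociated (ξ : ℝ) (W : ℕ → M2) : Prop :=
  IsFibP W ∧ UnboundedSeq W ∧ AdmissibleFib W ∧
  ∃ c₁ c₂ c₃ c₄ c₅ c₆ : ℝ, 0 < c₁ ∧ 0 < c₂ ∧ 0 < c₃ ∧ 0 < c₄ ∧ 0 < c₅ ∧ 0 < c₆ ∧
    ∀ i, 1 ≤ i →
      c₁ * mnorm (W i) ^ gam ≤ mnorm (W (i + 1)) ∧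
      mnorm (W (i + 1)) ≤ c₂ * mnorm (W i) ^ gam ∧
      c₃ * (mnorm (W i))⁻¹ ≤ xiNorm ξ (W i) ∧
      xiNorm ξ (W i) ≤ c₄ * (mnorm (W i))⁻¹ ∧
      c₅ ≤ |((W i).det : ℝ)| ∧ |((W i).det : ℝ)| ≤ c₆

/-- Membership in GL₂(ℤ): integer matrix of determinant ±1. -/
def InGL2Z (A : M2) : Prop := A.det = 1 ∨ A.det = -1

/-- ξ is badly approximable: irrational and |ξ - p/q| > c/q² for all rationals p/q. -/
def BadlyApprox (ξ : ℝ) : Prop :=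
  Irrational ξ ∧ ∃ c : ℝ, 0 < c ∧ ∀ p q : ℤ, q ≠ 0 → c / (q : ℝ) ^ 2 < |ξ - (p : ℝ) / (q : ℝ)|

/-- Partial quotients of the continued fraction expansion: `cfA n ξ` is `aₙ`
where ξ = [a₀, a₁, a₂, …]. -/
noncomputable def cfA : ℕ → ℝ → ℤ
  | 0, ξ => ⌊ξ⌋
  | n + 1, ξ => cfA n (ξ - ⌊ξ⌋)⁻¹

/-- A Fibonacci sequence of words (indices from 1). -/
def FibWordSeq {α : Type} (w : ℕ → List α) : Prop := ∀ i, 1 ≤ i → w (i + 2) = w (i + 1) ++ w i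

/-- `b` (indexed from 1: the limit word is b₁b₂b₃…) is the infinite limit word of the
sequence of words `w`: every `w k` (k ≥ 2) is a prefix of it, and their lengths are unbounded. -/
def IsLimitWord {α : Type} (w : ℕ → List α) (b : ℕ → α) : Prop :=
  (∀ n : ℕ, ∃ k, 2 ≤ k ∧ n ≤ (w k).length) ∧
  ∀ k, 2 ≤ k → ∀ j, (h : j < (w k).length) → (w k).get ⟨j, h⟩ = b (j + 1)

/-- The Fibonacci sequence of words over the alphabet E = {a, b} (with `b = false`,
`a = true`): w₁ = b, w₂ = a, w_{k+2} = w_{k+1} w_k.  Its limit is f_{a,b}. -/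
def fw : ℕ → List Bool
  | 0 => []
  | 1 => [false]
  | 2 => [true]
  | n + 3 => fw (n + 2) ++ fw (n + 1)

/-- The prefix of length `i` of the infinite Fibonacci word `f_{a,b}`
(note `fw (i+2)` is a prefix of `f_{a,b}` of length ≥ i). -/
def fpref (i : ℕ) : List Bool := (fw (i + 2)).take i

/-- The monoid morphism Φ : E* → (𝒫, *) with Φ(b) = W₁, Φ(a) = W₂
(the letter `b` is `false` and `a` is `true`). -/
def PhiW (W1 W2 : M2) : List Bool → M2
  | [] => 1
  | x :: u => pmul (if x then W2 else W1) (PhiW W1 W2 u)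

/-- The set 𝒮₁ of real matrices (a b; c d) with a ≥ max{b,c} and min{b,c} ≥ d ≥ 0. -/
def S1 : Set (Matrix (Fin 2) (Fin 2) ℝ) :=
  {A | max (A 0 1) (A 1 0) ≤ A 0 0 ∧ A 1 1 ≤ min (A 0 1) (A 1 0) ∧ 0 ≤ A 1 1}

/-- The set 𝒮 = 𝒮₁ ∩ GL₂(ℤ), viewed as a set of integer matrices. -/
def Sset : Set M2 :=
  {A | (A.map (Int.cast : ℤ → ℝ)) ∈ S1 ∧ (A.det = 1 ∨ A.det = -1)}

/-- ξ is an extremal real number with an associated Fibonacci sequence in GL₂(ℤ). -/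
def HasGLAssoc (ξ : ℝ) : Prop :=
  IsExtremal ξ ∧ ∃ W : ℕ → M2, IsAssociated ξ W ∧ ∀ i, 1 ≤ i → InGL2Z (W i)

/-- ξ is an extremal real number with an associated Fibonacci sequence in 𝒮. -/
def HasSAssoc (ξ : ℝ) : Prop :=
  IsExtremal ξ ∧ ∃ W : ℕ → M2, IsAssociated ξ W ∧ ∀ i, 1 ≤ i → W i ∈ Sset

lemma gam_sq : gam ^ 2 = gam + 1 := by
  have h : Real.sqrt 5 ^ 2 = 5 := Real.sq_sqrt (by norm_num)
  unfold gam
  linear_combination h / 4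

lemma one_lt_gam : 1 < gam := by
  have h : (1 : ℝ) < Real.sqrt 5 := Real.lt_sqrt_of_sq_lt (by norm_num)
  unfold gam
  linarith

lemma gam_lt_two : gam < 2 := by
  nlinarith [gam_sq, one_lt_gam]

/-- A quasi-multiplicative Fibonacci recurrence forces growth of order `gam`. -/
lemma exists_rpow_gam_bounds {X : ℕ → ℝ} {c : ℝ} (hc : 0 < c) (hX : ∀ n, 1 ≤ X n)
    (hlow : ∀ n, c * (X (n + 1) * X n) ≤ X (n + 2))
    (hupp : ∀ n, X (n + 2) ≤ 2 * (X (n + 1) * X n)) :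
    ∃ D : ℝ, 0 ≤ D ∧ ∀ n, Real.exp (-D) * X n ^ gam ≤ X (n + 1) ∧
      X (n + 1) ≤ Real.exp D * X n ^ gam := by
  have hpos : ∀ n, 0 < X n := fun n => lt_of_lt_of_le one_pos (hX n)
  set L : ℕ → ℝ := fun n => Real.log (X n) with hL
  set B : ℝ := |Real.log c| + Real.log 2 with hB
  have hlog2 : 0 ≤ Real.log 2 := Real.log_nonneg (by norm_num)
  have hB0 : 0 ≤ B := by positivity
  have hrec : ∀ n, |L (n + 2) - L (n + 1) - L n| ≤ B := by
    intro n
    have hne := (hpos n).ne'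
    have hne' := (hpos (n + 1)).ne'
    have h1 := Real.log_le_log (mul_pos hc (mul_pos (hpos (n + 1)) (hpos n))) (hlow n)
    have h2 := Real.log_le_log (hpos (n + 2)) (hupp n)
    rw [Real.log_mul hc.ne' (mul_ne_zero hne' hne), Real.log_mul hne' hne] at h1
    rw [Real.log_mul two_ne_zero (mul_ne_zero hne' hne), Real.log_mul hne' hne] at h2
    have := neg_abs_le (Real.log c)
    have := abs_nonneg (Real.log c)
    rw [abs_le]
    constructor <;> simp only [hL, hB] <;> linarith
  have hg := one_lt_gam
  have hg2 : 0 < 2 - gam := by linarith [gam_lt_two]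
  set D : ℝ := |L 1 - gam * L 0| + B / (2 - gam) with hD
  have hD0 : 0 ≤ D := by positivity
  have hDB : B ≤ (2 - gam) * D := by
    have : (2 - gam) * (B / (2 - gam)) = B := by field_simp
    have h3 : 0 ≤ (2 - gam) * |L 1 - gam * L 0| := by positivity
    rw [hD, mul_add]
    linarith
  have hd : ∀ n, |L (n + 1) - gam * L n| ≤ D := by
    intro n
    induction n with
    | zero =>
      have : 0 ≤ B / (2 - gam) := by positivity
      simp only [zero_add, hD]
      linarith
    | succ n ih =>
      have he : L (n + 2) - gam * L (n + 1) =
          -(gam - 1) * (L (n + 1) - gam * L n) + (L (n + 2) - L (n + 1) - L n) := by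
        linear_combination (-L n) * gam_sq
      have h4 : |-(gam - 1) * (L (n + 1) - gam * L n)| ≤ (gam - 1) * D := by
        rw [abs_mul, abs_neg, abs_of_pos (by linarith : 0 < gam - 1)]
        exact mul_le_mul_of_nonneg_left ih (by linarith)
      show |L (n + 2) - gam * L (n + 1)| ≤ D
      rw [he]
      calc _ ≤ _ := abs_add_le _ _
        _ ≤ (gam - 1) * D + B := add_le_add h4 (hrec n)
        _ ≤ D := by linarith
  refine ⟨D, hD0, fun n => ?_⟩
  have hn := abs_le.mp (hd n)
  have e1 : X n ^ gam = Real.exp (gam * L n) := by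
    rw [Real.rpow_def_of_pos (hpos n), mul_comm]
  have e2 : X (n + 1) = Real.exp (L (n + 1)) := (Real.exp_log (hpos _)).symm
  rw [e1, e2, ← Real.exp_add, ← Real.exp_add, Real.exp_le_exp, Real.exp_le_exp]
  constructor <;> linarith

lemma tendsto_atTop_of_rpow_gam_le {X : ℕ → ℝ} {D : ℝ} (hX : ∀ n, 1 ≤ X n)
    (hD : ∀ n, Real.exp (-D) * X n ^ gam ≤ X (n + 1)) (hunb : ∀ T : ℝ, ∃ n, T < X n) :
    Filter.Tendsto X Filter.atTop Filter.atTop := by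
  have hpos : ∀ n, 0 < X n := fun n => lt_of_lt_of_le one_pos (hX n)
  have hg : 0 < gam - 1 := by linarith [one_lt_gam]
  obtain ⟨m, hm⟩ := hunb (Real.exp ((D + 1) / (gam - 1)))
  have hstep : ∀ n, gam * Real.log (X n) - D ≤ Real.log (X (n + 1)) := by
    intro n
    have h := Real.log_le_log (mul_pos (Real.exp_pos _) (Real.rpow_pos_of_pos (hpos n) _)) (hD n)
    rw [Real.log_mul (Real.exp_pos _).ne' (Real.rpow_pos_of_pos (hpos n) _).ne', Real.log_exp,
      Real.log_rpow (hpos n)] at h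
    linarith
  have hm' : D + 1 ≤ (gam - 1) * Real.log (X m) := by
    have h := Real.log_le_log (Real.exp_pos _) hm.le
    rw [Real.log_exp, div_le_iff₀ hg] at h
    linarith
  have hlin : ∀ k : ℕ, Real.log (X m) + k ≤ Real.log (X (m + k)) := by
    intro k
    induction k with
    | zero => simp
    | succ k ih =>
      have h1 := hstep (m + k)
      have h2 : (gam - 1) * Real.log (X m) ≤ (gam - 1) * Real.log (X (m + k)) :=
        mul_le_mul_of_nonneg_left (by linarith [Nat.cast_nonneg (α := ℝ) k]) hg.le
      rw [← add_assoc]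
      push_cast
      linarith
  have h1 : Filter.Tendsto (fun k => X (k + m)) Filter.atTop Filter.atTop := by
    refine Filter.tendsto_atTop_mono (fun k => ?_) tendsto_natCast_atTop_atTop
    have h2 := Real.log_le_sub_one_of_pos (hpos (m + k))
    have h3 := Real.log_nonneg (hX m)
    have := hlin k
    rw [add_comm k m]
    linarith
  exact (Filter.tendsto_add_atTop_iff_nat m).mp h1

/-- A sequence whose increments are bounded by `K / X n ^ 2`, with `X` at least doubling,
converges with rate `1 / X n ^ 2`. -/
lemma exists_limit_of_increment_le {u X : ℕ → ℝ} {K : ℝ} {m : ℕ} (hK : 0 ≤ K)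
    (hX : ∀ n, 0 < X n) (hdbl : ∀ n, m ≤ n → 2 * X n ≤ X (n + 1))
    (hu : ∀ n, m ≤ n → |u (n + 1) - u n| ≤ K / X n ^ 2) :
    ∃ l, Filter.Tendsto u Filter.atTop (nhds l) ∧ ∀ n, m ≤ n → |u n - l| ≤ 2 * K / X n ^ 2 := by
  have hgeo : ∀ n, m ≤ n → ∀ k : ℕ, 2 ^ k * X n ≤ X (n + k) := by
    intro n hn k
    induction k with
    | zero => simp
    | succ k ih =>
      have := hdbl (n + k) (by omega)
      rw [← add_assoc, pow_succ]
      linarith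
  have hd : ∀ n, m ≤ n → ∀ k, dist (u (n + k)) (u (n + (k + 1))) ≤ K / X n ^ 2 * (1 / 2) ^ k := by
    intro n hn k
    rw [dist_comm, Real.dist_eq, ← add_assoc]
    refine (hu (n + k) (by omega)).trans ?_
    have h1 := hgeo n hn k
    have h2 : (1 : ℝ) ≤ 2 ^ k := one_le_pow₀ (by norm_num)
    have h3 := hX n
    have h4 : 2 ^ k * X n ^ 2 ≤ X (n + k) ^ 2 := by
      calc 2 ^ k * X n ^ 2 ≤ 2 ^ k * (2 ^ k * X n ^ 2) := by
            apply le_mul_of_one_le_left (by positivity) h2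
        _ = (2 ^ k * X n) ^ 2 := by ring
        _ ≤ _ := by gcongr
    calc K / X (n + k) ^ 2 ≤ K / (2 ^ k * X n ^ 2) := by gcongr
      _ = K / X n ^ 2 * (1 / 2) ^ k := by rw [one_div, inv_pow]; field_simp
  obtain ⟨l, hl⟩ := cauchySeq_tendsto_of_complete
    (cauchySeq_of_le_geometric (f := fun k => u (m + k)) _ _ (by norm_num) (hd m le_rfl))
  have hl' : Filter.Tendsto u Filter.atTop (nhds l) := by
    rw [← Filter.tendsto_add_atTop_iff_nat m]
    simpa only [add_comm] using hl
  refine ⟨l, hl', fun n hn => ?_⟩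
  have hln : Filter.Tendsto (fun k => u (n + k)) Filter.atTop (nhds l) := by
    simpa only [add_comm n] using (Filter.tendsto_add_atTop_iff_nat n).mpr hl'
  have h := dist_le_of_le_geometric_of_tendsto₀ (f := fun k => u (n + k)) _ _ (by norm_num)
    (hd n hn) hln
  rw [Real.dist_eq] at h
  refine h.trans (le_of_eq ?_)
  ring

/-- Symmetric matrices `(p n, q n; q n, r n)` of bounded determinant whose consecutive terms are
nearly proportional converge projectively to a degenerate one, and every linear form vanishing at
the limit is `O(1 / X n)` along the sequence. -/
lemma exists_projective_limit {p q r X : ℕ → ℝ} {c k D k' B : ℝ} (hc : 0 < c) (hk : 0 < k)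
    (hk' : 0 < k') (hB : 0 ≤ B) (hX : ∀ n, 1 ≤ X n)
    (hlim : Filter.Tendsto X Filter.atTop Filter.atTop)
    (hlow : ∀ n, c * (X (n + 1) * X n) ≤ X (n + 2))
    (hnorm : ∀ n, X n ^ 2 ≤ k ^ 2 * (p n ^ 2 + 2 * q n ^ 2 + r n ^ 2))
    (hdet : ∀ n, |p n * r n - q n ^ 2| ≤ D) (htr : ∀ n, |p n + r n| ≤ k' * X n)
    (hp : ∀ n, |p (n + 2) * (p (n + 1) + r (n + 1)) - p (n + 1) * (p (n + 2) + r (n + 2))|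
      ≤ B * X n)
    (hq : ∀ n, |q (n + 2) * (p (n + 1) + r (n + 1)) - q (n + 1) * (p (n + 2) + r (n + 2))|
      ≤ B * X n)
    (hr : ∀ n, |r (n + 2) * (p (n + 1) + r (n + 1)) - r (n + 1) * (p (n + 2) + r (n + 2))|
      ≤ B * X n) :
    ∃ α β δ K : ℝ, ∃ m : ℕ, 0 ≤ K ∧ α + δ = 1 ∧ α * δ = β ^ 2 ∧
      ∀ f g h : ℝ, f * α + g * β + h * δ = 0 → ∀ n, m ≤ n →
        |f * p n + g * q n + h * r n| ≤ K * (|f| + |g| + |h|) / X n := by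
  have hpos : ∀ n, 0 < X n := fun n => lt_of_lt_of_le one_pos (hX n)
  have hD : 0 ≤ D := (abs_nonneg _).trans (hdet 0)
  obtain ⟨m, hm⟩ := Filter.eventually_atTop.mp
    (hlim.eventually_ge_atTop (2 / c + 4 * k ^ 2 * D))
  have hkD : 0 ≤ 4 * k ^ 2 * D := by positivity
  have h2c : 0 < 2 / c := by positivity
  have hdbl : ∀ n, m + 1 ≤ n → 2 * X n ≤ X (n + 1) := by
    intro n hn
    obtain ⟨j, rfl⟩ : ∃ j, n = j + 1 := ⟨n - 1, by omega⟩
    have h1 : 2 / c ≤ X j := by linarith [hm j (by omega)]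
    rw [div_le_iff₀ hc] at h1
    have := mul_le_mul_of_nonneg_left h1 (hpos (j + 1)).le
    linarith [hlow j]
  have ht : ∀ n, m ≤ n → X n / (2 * k) ≤ |p n + r n| := by
    intro n hn
    rw [← abs_of_pos (by have := hpos n; positivity : 0 < X n / (2 * k))]
    rw [← sq_le_sq, div_pow, div_le_iff₀ (by positivity)]
    have h1 := hm n hn
    have h2 : 4 * k ^ 2 * D ≤ X n ^ 2 := by nlinarith [hX n]
    have h3 := (abs_le.mp (hdet n)).1
    have h4 : -(k ^ 2 * D) ≤ k ^ 2 * (p n * r n - q n ^ 2) := by nlinarith [sq_nonneg k]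
    nlinarith [hnorm n]
  have ht0 : ∀ n, m ≤ n → p n + r n ≠ 0 := by
    intro n hn h0
    have h1 := ht n hn
    rw [h0, abs_zero] at h1
    have := hpos n
    have : 0 < X n / (2 * k) := by positivity
    linarith
  set K : ℝ := B * (2 * k) ^ 2 / c with hKdef
  have hK : 0 ≤ K := by positivity
  have key : ∀ y : ℕ → ℝ,
      (∀ n, |y (n + 2) * (p (n + 1) + r (n + 1)) - y (n + 1) * (p (n + 2) + r (n + 2))|
        ≤ B * X n) →
      ∀ n, m + 1 ≤ n → |y (n + 1) / (p (n + 1) + r (n + 1)) - y n / (p n + r n)| ≤ K / X n ^ 2 := by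
    intro y hy n hn
    obtain ⟨j, rfl⟩ : ∃ j, n = j + 1 := ⟨n - 1, by omega⟩
    have e1 := ht0 (j + 1) (by omega)
    have e2 := ht0 (j + 1 + 1) (by omega)
    have x0 := hpos j
    have x1 := hpos (j + 1)
    have x2 := hpos (j + 2)
    rw [div_sub_div _ _ e2 e1, abs_div, abs_mul]
    have h1 : X (j + 2) / (2 * k) * (X (j + 1) / (2 * k)) ≤
        |p (j + 1 + 1) + r (j + 1 + 1)| * |p (j + 1) + r (j + 1)| :=
      mul_le_mul (ht (j + 2) (by omega)) (ht (j + 1) (by omega)) (by positivity) (abs_nonneg _)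
    have h2 : |y (j + 1 + 1) * (p (j + 1) + r (j + 1)) - (p (j + 1 + 1) + r (j + 1 + 1)) * y (j + 1)|
        ≤ B * X j := by
      rw [mul_comm _ (y (j + 1))]
      exact hy j
    have h3 : c * (X (j + 1) * X j) / (2 * k) * (X (j + 1) / (2 * k)) ≤
        X (j + 2) / (2 * k) * (X (j + 1) / (2 * k)) := by
      have := hlow j
      gcongr
    calc _ ≤ B * X j / (c * (X (j + 1) * X j) / (2 * k) * (X (j + 1) / (2 * k))) :=
          div_le_div₀ (by positivity) h2 (by positivity) (h3.trans h1)
      _ = K / X (j + 1) ^ 2 := by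
          rw [hKdef]
          field_simp
  obtain ⟨α, hα, hα'⟩ := exists_limit_of_increment_le
    (u := fun n => p n / (p n + r n)) hK hpos hdbl (key p hp)
  obtain ⟨β, hβ, hβ'⟩ := exists_limit_of_increment_le
    (u := fun n => q n / (p n + r n)) hK hpos hdbl (key q hq)
  obtain ⟨δ, hδ, hδ'⟩ := exists_limit_of_increment_le
    (u := fun n => r n / (p n + r n)) hK hpos hdbl (key r hr)
  refine ⟨α, β, δ, k' * (2 * K), m + 1, by positivity, ?_, ?_, ?_⟩
  · refine tendsto_nhds_unique (hα.add hδ) ?_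
    refine tendsto_const_nhds.congr' ?_
    filter_upwards [Filter.eventually_ge_atTop m] with n hn
    rw [← add_div, div_self (ht0 n hn)]
  · have h1 := (hα.mul hδ).sub (hβ.pow 2)
    have h2 : Filter.Tendsto (fun n => D * (2 * k) ^ 2 / X n) Filter.atTop (nhds 0) :=
      hlim.const_div_atTop _
    refine sub_eq_zero.mp (tendsto_nhds_unique h1 (squeeze_zero_norm' ?_ h2))
    filter_upwards [Filter.eventually_ge_atTop m] with n hn
    have h3 := ht n hn
    have x0 := hpos n
    have e : p n / (p n + r n) * (r n / (p n + r n)) - (q n / (p n + r n)) ^ 2 =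
        (p n * r n - q n ^ 2) / (p n + r n) ^ 2 := by
      have := ht0 n hn
      field_simp
    rw [e, Real.norm_eq_abs, abs_div, abs_pow]
    have h4 : X n / (2 * k) ^ 2 ≤ |p n + r n| ^ 2 := by
      calc X n / (2 * k) ^ 2 ≤ X n ^ 2 / (2 * k) ^ 2 := by
            gcongr
            nlinarith [hX n]
        _ = (X n / (2 * k)) ^ 2 := by rw [div_pow]
        _ ≤ _ := by gcongr
    calc _ ≤ D / (X n / (2 * k) ^ 2) := div_le_div₀ hD (hdet n) (by positivity) h4
      _ = _ := by field_simp
  · intro f g h hfgh n hn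
    have e0 := ht0 n (by omega)
    have e : f * p n + g * q n + h * r n = (p n + r n) * (f * (p n / (p n + r n) - α) +
        g * (q n / (p n + r n) - β) + h * (r n / (p n + r n) - δ)) := by
      have : f * (p n / (p n + r n) - α) + g * (q n / (p n + r n) - β) +
          h * (r n / (p n + r n) - δ) = (f * p n + g * q n + h * r n) / (p n + r n) := by
        rw [add_div, add_div]
        linear_combination -hfgh
      rw [this, mul_div_cancel₀ _ e0]
    have x0 := hpos n
    rw [e, abs_mul]
    have hsum : |f * (p n / (p n + r n) - α) + g * (q n / (p n + r n) - β) +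
        h * (r n / (p n + r n) - δ)| ≤ (|f| + |g| + |h|) * (2 * K / X n ^ 2) := by
      calc _ ≤ _ := abs_add_three _ _ _
        _ ≤ |f| * (2 * K / X n ^ 2) + |g| * (2 * K / X n ^ 2) + |h| * (2 * K / X n ^ 2) := by
          rw [abs_mul, abs_mul, abs_mul]
          gcongr
          exacts [hα' n hn, hβ' n hn, hδ' n hn]
        _ = _ := by ring
    calc _ ≤ k' * X n * ((|f| + |g| + |h|) * (2 * K / X n ^ 2)) :=
          mul_le_mul (htr n) hsum (abs_nonneg _) (by positivity)
      _ = _ := by field_simp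

lemma abs_entry_le_mnorm (A : M2) (i j : Fin 2) : |(A i j : ℝ)| ≤ mnorm A := by
  fin_cases i <;> fin_cases j <;> simp [mnorm]

lemma mnorm_le {A : M2} {T : ℝ} (h : ∀ i j, |(A i j : ℝ)| ≤ T) : mnorm A ≤ T :=
  max_le (max_le (h 0 0) (h 0 1)) (max_le (h 1 0) (h 1 1))

lemma mnorm_nonneg (A : M2) : 0 ≤ mnorm A :=
  (abs_nonneg _).trans (abs_entry_le_mnorm A 0 0)

lemma mnorm_mul_le (A B : M2) : mnorm (A * B) ≤ 2 * (mnorm A * mnorm B) := by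
  refine mnorm_le fun i j => ?_
  rw [Matrix.mul_apply, Fin.sum_univ_two]
  push_cast
  have h : ∀ k, |(A i k : ℝ) * (B k j : ℝ)| ≤ mnorm A * mnorm B := fun k => by
    rw [abs_mul]
    exact mul_le_mul (abs_entry_le_mnorm A i k) (abs_entry_le_mnorm B k j) (abs_nonneg _)
      (mnorm_nonneg A)
  linarith [abs_add_le ((A i 0 : ℝ) * (B 0 j : ℝ)) ((A i 1 : ℝ) * (B 1 j : ℝ)), h 0, h 1]

lemma mnorm_smul_ge {k : ℤ} (hk : k ≠ 0) (A : M2) : mnorm A ≤ mnorm (k • A) := by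
  refine mnorm_le fun i j => le_trans ?_ (abs_entry_le_mnorm (k • A) i j)
  have h : (1 : ℝ) ≤ |(k : ℝ)| := by exact_mod_cast Int.one_le_abs hk
  simp only [Matrix.smul_apply, smul_eq_mul, Int.cast_mul, abs_mul]
  exact le_mul_of_one_le_left (abs_nonneg _) h

lemma mnorm_adjugate_le (A : M2) : mnorm A.adjugate ≤ mnorm A := by
  rw [Matrix.adjugate_fin_two]
  refine mnorm_le fun i j => ?_
  fin_cases i <;> fin_cases j <;> simp [abs_entry_le_mnorm]

lemma mnorm_transpose_le (A : M2) : mnorm Aᵀ ≤ mnorm A :=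
  mnorm_le fun i j => abs_entry_le_mnorm A j i

lemma one_le_mnorm {A : M2} (h : A.det ≠ 0) : 1 ≤ mnorm A := by
  by_contra! hlt
  have h0 : ∀ i j, A i j = 0 := fun i j => by
    have h1 := (abs_entry_le_mnorm A i j).trans_lt hlt
    exact Int.abs_lt_one_iff.mp (by exact_mod_cast h1)
  exact h (by simp [Matrix.det_fin_two, h0])

lemma abs_det_le_mnorm_sq (A : M2) : |(A.det : ℝ)| ≤ 2 * mnorm A ^ 2 := by
  rw [Matrix.det_fin_two]
  push_cast
  have h : ∀ i j k l, |(A i j : ℝ) * (A k l : ℝ)| ≤ mnorm A ^ 2 := fun i j k l => by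
    rw [abs_mul, sq]
    exact mul_le_mul (abs_entry_le_mnorm A i j) (abs_entry_le_mnorm A k l) (abs_nonneg _)
      (mnorm_nonneg A)
  linarith [abs_sub (A 0 0 * A 1 1 : ℝ) (A 0 1 * A 1 0 : ℝ), h 0 0 1 1, h 0 1 1 0]

lemma content_smul_red (A : M2) : (content A : ℤ) • red A = A := by
  have h : ∀ i j, content A ∣ (A i j).natAbs := by
    intro i j
    fin_cases i <;> fin_cases j
    · exact (Nat.gcd_dvd_left _ _).trans (Nat.gcd_dvd_left _ _)
    · exact (Nat.gcd_dvd_left _ _).trans (Nat.gcd_dvd_right _ _)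
    · exact (Nat.gcd_dvd_right _ _).trans (Nat.gcd_dvd_left _ _)
    · exact (Nat.gcd_dvd_right _ _).trans (Nat.gcd_dvd_right _ _)
  ext i j
  simp only [Matrix.smul_apply, red, Matrix.of_apply, smul_eq_mul]
  exact Int.mul_ediv_cancel' (Int.natCast_dvd.mpr (h i j))

lemma content_ne_zero {A : M2} (h : A.det ≠ 0) : content A ≠ 0 := by
  intro h0
  have h1 := content_smul_red A
  rw [h0, Nat.cast_zero, zero_smul] at h1
  exact h (by rw [← h1]; simp)

/-- If `s z = y A x` with `x`, `y`, `z` symmetric, the determinant of the coordinates of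
`x`, `y`, `z` is governed by the skew part of `A`. -/
lemma smul_det_of_symm_product {R : Type*} [CommRing R] {s p q r p' q' r' p'' q'' r'' a b c e : R}
    (h00 : s * p'' = (p' * a + q' * c) * p + (p' * b + q' * e) * q)
    (h01 : s * q'' = (p' * a + q' * c) * q + (p' * b + q' * e) * r)
    (h10 : s * q'' = (q' * a + r' * c) * p + (q' * b + r' * e) * q)
    (h11 : s * r'' = (q' * a + r' * c) * q + (q' * b + r' * e) * r) :
    s * (p * (q' * r'' - r' * q'') - q * (p' * r'' - r' * p'') + r * (p' * q'' - q' * p'')) =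
      -((p * r - q ^ 2) * (p' * r' - q' ^ 2) * (b - c)) := by
  linear_combination (p * q' - q * p') * h11 + (q * r' - r * q') * h00 + (r * p' - p * r') * h01 -
    (r * p' - q * q') * (h01 - h10)

/-- A Fibonacci sequence of matrices up to scalars, together with multipliers of period two which
make it symmetric. -/
structure SymmFib (V M : ℕ → M2) (e : ℕ → ℤ) : Prop where
  scalar_ne : ∀ n, e n ≠ 0
  recur : ∀ n, e n • V (n + 2) = V (n + 1) * V n
  period : ∀ n, M (n + 2) = M n
  det_ne : ∀ n, (V n).det ≠ 0
  det_mult_ne : ∀ n, (M n).det ≠ 0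
  skew_ne : ∀ n, M n 0 1 ≠ M n 1 0
  symm : ∀ n, (V n * M n) 1 0 = (V n * M n) 0 1

namespace SymmFib

variable {V M : ℕ → M2} {e : ℕ → ℤ}

lemma recur_symm (h : SymmFib V M e) (n : ℕ) :
    e n • (V (n + 2) * M (n + 2)) = V (n + 1) * (V n * M n) := by
  rw [← Matrix.smul_mul, h.recur, h.period, Matrix.mul_assoc]

lemma det_smul_eq (n : ℕ) : (M n).det • V n = V n * M n * (M n).adjugate := by
  rw [Matrix.mul_assoc, Matrix.mul_adjugate, Matrix.mul_smul, Matrix.mul_one]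

lemma linear_independent (h : SymmFib V M e) (n : ℕ) {f g k : ℤ}
    (hv : ∀ j ≤ 2, f * (V (n + j) * M (n + j)) 0 0 + g * (V (n + j) * M (n + j)) 0 1 +
      k * (V (n + j) * M (n + j)) 1 1 = 0) : f = 0 ∧ g = 0 ∧ k = 0 := by
  have hx := hv 0 (by norm_num)
  have hy := hv 1 (by norm_num)
  have hz := hv 2 (by norm_num)
  rw [add_zero] at hx
  have hdx : (V n * M n).det ≠ 0 := by
    rw [Matrix.det_mul]; exact mul_ne_zero (h.det_ne _) (h.det_mult_ne _)
  have hdy : (V (n + 1) * M (n + 1)).det ≠ 0 := by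
    rw [Matrix.det_mul]; exact mul_ne_zero (h.det_ne _) (h.det_mult_ne _)
  have hprod : ((M (n + 1)).det * e n) • (V (n + 2) * M (n + 2)) =
      V (n + 1) * M (n + 1) * (M (n + 1)).adjugate * (V n * M n) := by
    rw [mul_smul, h.recur_symm, ← Matrix.smul_mul, det_smul_eq]
  have sx := h.symm n
  have sy := h.symm (n + 1)
  have sz := h.symm (n + 2)
  have hA := Matrix.adjugate_fin_two (M (n + 1))
  have hskew : (M (n + 1)).adjugate 0 1 - (M (n + 1)).adjugate 1 0 ≠ 0 := by
    rw [hA]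
    simp only [Matrix.of_apply, Matrix.cons_val', Matrix.cons_val_zero, Matrix.cons_val_one,
      Matrix.cons_val_fin_one]
    have := h.skew_ne (n + 1)
    omega
  generalize (M (n + 1)).adjugate = A at *
  generalize V n * M n = x at *
  generalize V (n + 1) * M (n + 1) = y at *
  generalize V (n + 2) * M (n + 2) = z at *
  have hent : ∀ i j, ((M (n + 1)).det * e n) * z i j = (y i 0 * A 0 0 + y i 1 * A 1 0) * x 0 j +
      (y i 0 * A 0 1 + y i 1 * A 1 1) * x 1 j := by
    intro i j
    have := congrFun (congrFun hprod i) j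
    simpa only [Matrix.smul_apply, smul_eq_mul, Matrix.mul_apply, Fin.sum_univ_two] using this
  have h00 := hent 0 0
  have h01 := hent 0 1
  have h10 := hent 1 0
  have h11 := hent 1 1
  rw [sx] at h00 h10
  rw [sy] at h10 h11
  rw [sz] at h10
  have hdet := smul_det_of_symm_product h00 h01 h10 h11
  rw [Matrix.det_fin_two, sx] at hdx
  rw [Matrix.det_fin_two, sy] at hdy
  have hne : x 0 0 * (y 0 1 * z 1 1 - y 1 1 * z 0 1) - x 0 1 * (y 0 0 * z 1 1 - y 1 1 * z 0 0) +
      x 1 1 * (y 0 0 * z 0 1 - y 0 1 * z 0 0) ≠ 0 := by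
    intro h0
    rw [h0, mul_zero, eq_comm, neg_eq_zero, sq, sq] at hdet
    exact mul_ne_zero (mul_ne_zero hdx hdy) hskew hdet
  refine ⟨(mul_eq_zero.mp ?_).resolve_right hne, (mul_eq_zero.mp ?_).resolve_right hne,
    (mul_eq_zero.mp ?_).resolve_right hne⟩
  · linear_combination (y 0 1 * z 1 1 - y 1 1 * z 0 1) * hx + (z 0 1 * x 1 1 - z 1 1 * x 0 1) * hy +
      (x 0 1 * y 1 1 - x 1 1 * y 0 1) * hz
  · linear_combination (y 1 1 * z 0 0 - y 0 0 * z 1 1) * hx + (z 1 1 * x 0 0 - z 0 0 * x 1 1) * hy +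
      (x 1 1 * y 0 0 - x 0 0 * y 1 1) * hz
  · linear_combination (y 0 0 * z 0 1 - y 0 1 * z 0 0) * hx + (z 0 0 * x 0 1 - z 0 1 * x 0 0) * hy +
      (x 0 0 * y 0 1 - x 0 1 * y 0 0) * hz

lemma one_le_mnorm (h : SymmFib V M e) (n : ℕ) : 1 ≤ mnorm (V n) :=
  _root_.one_le_mnorm (h.det_ne n)

lemma mnorm_symm_le {ν : ℝ} (hν : ∀ n, mnorm (M n) ≤ ν) (n : ℕ) :
    mnorm (V n * M n) ≤ 2 * ν * mnorm (V n) := by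
  have := mul_le_mul_of_nonneg_left (hν n) (mnorm_nonneg (V n))
  linarith [mnorm_mul_le (V n) (M n)]

lemma mnorm_le_symm (h : SymmFib V M e) {ν : ℝ} (hν : ∀ n, mnorm (M n) ≤ ν) (n : ℕ) :
    mnorm (V n) ≤ 2 * ν * mnorm (V n * M n) := by
  have h1 := mnorm_smul_ge (h.det_mult_ne n) (V n)
  rw [det_smul_eq] at h1
  have h2 := mnorm_mul_le (V n * M n) (M n).adjugate
  have := mul_le_mul_of_nonneg_left ((mnorm_adjugate_le (M n)).trans (hν n))
    (mnorm_nonneg (V n * M n))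
  linarith

lemma mnorm_recur_le (h : SymmFib V M e) (n : ℕ) :
    mnorm (V (n + 2)) ≤ 2 * (mnorm (V (n + 1)) * mnorm (V n)) := by
  have h1 := mnorm_smul_ge (h.scalar_ne n) (V (n + 2))
  rw [h.recur] at h1
  exact h1.trans (mnorm_mul_le _ _)

/-- Columns of consecutive symmetric matrices are nearly parallel. -/
lemma abs_cross_le (h : SymmFib V M e) {C ν : ℝ} (hC : ∀ n, |((V n).det : ℝ)| ≤ C)
    (hν : ∀ n, mnorm (M n) ≤ ν) (n : ℕ) (j k : Fin 2) :
    |((V (n + 1) * M (n + 1)) 0 j : ℝ) * ((V (n + 2) * M (n + 2)) 1 k : ℝ) -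
      ((V (n + 1) * M (n + 1)) 1 j : ℝ) * ((V (n + 2) * M (n + 2)) 0 k : ℝ)| ≤
      4 * C * ν ^ 2 * mnorm (V n) := by
  have hent : ∀ i, e n * (V (n + 2) * M (n + 2)) i k =
      V (n + 1) i 0 * (V n * M n) 0 k + V (n + 1) i 1 * (V n * M n) 1 k := by
    intro i
    have := congrFun (congrFun (h.recur_symm n) i) k
    rw [Matrix.mul_apply (M := V (n + 1)), Fin.sum_univ_two] at this
    simpa only [Matrix.smul_apply, smul_eq_mul] using this
  have hM : ∀ i, (V (n + 1) * M (n + 1)) i j =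
      V (n + 1) i 0 * M (n + 1) 0 j + V (n + 1) i 1 * M (n + 1) 1 j := by
    intro i
    rw [Matrix.mul_apply, Fin.sum_univ_two]
  have hdet : (V (n + 1)).det = V (n + 1) 0 0 * V (n + 1) 1 1 - V (n + 1) 0 1 * V (n + 1) 1 0 :=
    Matrix.det_fin_two _
  have hx := mnorm_symm_le (V := V) hν n
  have b0 := (abs_entry_le_mnorm (V n * M n) 0 k).trans hx
  have b1 := (abs_entry_le_mnorm (V n * M n) 1 k).trans hx
  have m0 := (abs_entry_le_mnorm (M (n + 1)) 0 j).trans (hν _)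
  have m1 := (abs_entry_le_mnorm (M (n + 1)) 1 j).trans (hν _)
  have he : (1 : ℝ) ≤ |(e n : ℝ)| := by exact_mod_cast Int.one_le_abs (h.scalar_ne n)
  have hid : (e n : ℝ) * (((V (n + 1) * M (n + 1)) 0 j : ℝ) * ((V (n + 2) * M (n + 2)) 1 k : ℝ) -
      ((V (n + 1) * M (n + 1)) 1 j : ℝ) * ((V (n + 2) * M (n + 2)) 0 k : ℝ)) =
      ((V (n + 1)).det : ℝ) * ((M (n + 1) 0 j : ℝ) * ((V n * M n) 1 k : ℝ) -
        (M (n + 1) 1 j : ℝ) * ((V n * M n) 0 k : ℝ)) := by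
    have h0 := hent 0
    have h1 := hent 1
    rw [hdet, hM, hM]
    generalize V n * M n = x at *
    generalize V (n + 2) * M (n + 2) = z at *
    have h0' : (e n : ℝ) * (z 0 k : ℝ) = V (n + 1) 0 0 * x 0 k + V (n + 1) 0 1 * x 1 k := by
      exact_mod_cast h0
    have h1' : (e n : ℝ) * (z 1 k : ℝ) = V (n + 1) 1 0 * x 0 k + V (n + 1) 1 1 * x 1 k := by
      exact_mod_cast h1
    push_cast
    linear_combination (V (n + 1) 0 0 * M (n + 1) 0 j + V (n + 1) 0 1 * M (n + 1) 1 j : ℝ) * h1' -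
      (V (n + 1) 1 0 * M (n + 1) 0 j + V (n + 1) 1 1 * M (n + 1) 1 j : ℝ) * h0'
  have hν0 : 0 ≤ ν := (mnorm_nonneg _).trans (hν 0)
  have hT : 0 ≤ 2 * ν * mnorm (V n) := (abs_nonneg _).trans b0
  have hin : |(M (n + 1) 0 j : ℝ) * ((V n * M n) 1 k : ℝ) -
      (M (n + 1) 1 j : ℝ) * ((V n * M n) 0 k : ℝ)| ≤
      ν * (2 * ν * mnorm (V n)) + ν * (2 * ν * mnorm (V n)) := by
    refine (abs_sub _ _).trans ?_
    rw [abs_mul, abs_mul]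
    gcongr
  have hC0 : 0 ≤ C := (abs_nonneg _).trans (hC 0)
  calc _ ≤ |(e n : ℝ)| * _ := le_mul_of_one_le_left (abs_nonneg _) he
    _ = _ := by rw [← abs_mul, hid, abs_mul]
    _ ≤ C * (ν * (2 * ν * mnorm (V n)) + ν * (2 * ν * mnorm (V n))) :=
      mul_le_mul (hC _) hin (abs_nonneg _) hC0
    _ = _ := by ring

/-- Real linear forms vanishing at the projective limit of the symmetric matrices are
`O(1 / ‖V n‖)` along the sequence. -/
lemma exists_linear_form_bound (h : SymmFib V M e) {c C ν : ℝ} (hc : 0 < c) (hν0 : 0 < ν)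
    (hC : ∀ n, |((V n).det : ℝ)| ≤ C) (hν : ∀ n, mnorm (M n) ≤ ν)
    (hlow : ∀ n, c * (mnorm (V (n + 1)) * mnorm (V n)) ≤ mnorm (V (n + 2)))
    (hlim : Filter.Tendsto (fun n => mnorm (V n)) Filter.atTop Filter.atTop) :
    ∃ α β δ K : ℝ, ∃ m : ℕ, 0 ≤ K ∧ α + δ = 1 ∧ α * δ = β ^ 2 ∧
      ∀ f g k : ℝ, f * α + g * β + k * δ = 0 → ∀ n, m ≤ n →
        |f * (V n * M n) 0 0 + g * (V n * M n) 0 1 + k * (V n * M n) 1 1| ≤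
          K * (|f| + |g| + |k|) / mnorm (V n) := by
  have hC0 : 0 ≤ C := (abs_nonneg _).trans (hC 0)
  have hcross := h.abs_cross_le hC hν
  refine exists_projective_limit (p := fun n => ((V n * M n) 0 0 : ℝ))
    (q := fun n => ((V n * M n) 0 1 : ℝ)) (r := fun n => ((V n * M n) 1 1 : ℝ))
    (k := 2 * ν) (D := C * (2 * ν ^ 2)) (k' := 4 * ν) (B := 8 * C * ν ^ 2) hc (by positivity)
    (by positivity) (by positivity) h.one_le_mnorm hlim hlow ?_ ?_ ?_ ?_ ?_ ?_
  · intro n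
    have h1 := h.mnorm_le_symm hν n
    have s := h.symm n
    generalize V n * M n = x at *
    have h2 : mnorm x ≤ √((x 0 0 : ℝ) ^ 2 + 2 * (x 0 1 : ℝ) ^ 2 + (x 1 1 : ℝ) ^ 2) := by
      refine mnorm_le fun i j => Real.abs_le_sqrt ?_
      have h0 := sq_nonneg (x 0 0 : ℝ)
      have h1 := sq_nonneg (x 0 1 : ℝ)
      have h2 := sq_nonneg (x 1 1 : ℝ)
      fin_cases i <;> fin_cases j <;> simp [s] <;> linarith
    have h3 := mnorm_nonneg (V n)
    calc mnorm (V n) ^ 2 ≤ (2 * ν * mnorm x) ^ 2 := by gcongr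
      _ = (2 * ν) ^ 2 * mnorm x ^ 2 := by ring
      _ ≤ (2 * ν) ^ 2 * (√((x 0 0 : ℝ) ^ 2 + 2 * (x 0 1 : ℝ) ^ 2 + (x 1 1 : ℝ) ^ 2)) ^ 2 := by
        have := mnorm_nonneg x
        gcongr
      _ = _ := by rw [Real.sq_sqrt (by positivity)]
  · intro n
    have e1 : ((V n * M n) 0 0 : ℝ) * ((V n * M n) 1 1 : ℝ) - ((V n * M n) 0 1 : ℝ) ^ 2 =
        ((V n).det : ℝ) * ((M n).det : ℝ) := by
      have := Matrix.det_mul (V n) (M n)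
      rw [Matrix.det_fin_two, h.symm, ← sq] at this
      exact_mod_cast this
    have e2 : |((M n).det : ℝ)| ≤ 2 * ν ^ 2 := by
      have := hν n
      have := mnorm_nonneg (M n)
      refine (abs_det_le_mnorm_sq _).trans ?_
      gcongr
    simp only [e1, abs_mul]
    exact mul_le_mul (hC n) e2 (abs_nonneg _) hC0
  · intro n
    have := mnorm_symm_le (V := V) hν n
    have := abs_entry_le_mnorm (V n * M n) 0 0
    have := abs_entry_le_mnorm (V n * M n) 1 1
    have := abs_add_le ((V n * M n) 0 0 : ℝ) ((V n * M n) 1 1 : ℝ)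
    linarith
  all_goals
    intro n
    have s1 := h.symm (n + 1)
    have s2 := h.symm (n + 2)
    have c00 := hcross n 0 0
    have c01 := hcross n 0 1
    have c10 := hcross n 1 0
    have c11 := hcross n 1 1
    rw [s1, s2] at c00
    rw [s1] at c01
    rw [s2] at c10
    rw [abs_le] at c00 c01 c10 c11 ⊢
    constructor <;> linarith

lemma int_form_eq_zero (h : SymmFib V M e)
    (hlim : Filter.Tendsto (fun n => mnorm (V n)) Filter.atTop Filter.atTop) {f g k : ℤ} {T : ℝ}
    {m : ℕ} (hb : ∀ n, m ≤ n →
      |(f : ℝ) * (V n * M n) 0 0 + (g : ℝ) * (V n * M n) 0 1 + (k : ℝ) * (V n * M n) 1 1| ≤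
        T / mnorm (V n)) : f = 0 ∧ g = 0 ∧ k = 0 := by
  obtain ⟨m', hm'⟩ := Filter.eventually_atTop.mp (hlim.eventually_gt_atTop T)
  refine h.linear_independent (m + m') fun j _ => ?_
  have h1 := hb (m + m' + j) (by omega)
  have h2 : T / mnorm (V (m + m' + j)) < 1 := by
    rw [div_lt_one (lt_of_lt_of_le one_pos (h.one_le_mnorm _))]
    exact hm' _ (by omega)
  exact Int.abs_lt_one_iff.mp (by exact_mod_cast h1.trans_lt h2)

/-- The projective limit is a point `(1, ξ, ξ²)` of the affine chart. -/
lemma exists_xi (h : SymmFib V M e) {c C ν : ℝ} (hc : 0 < c) (hν0 : 0 < ν)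
    (hC : ∀ n, |((V n).det : ℝ)| ≤ C) (hν : ∀ n, mnorm (M n) ≤ ν)
    (hlow : ∀ n, c * (mnorm (V (n + 1)) * mnorm (V n)) ≤ mnorm (V (n + 2)))
    (hlim : Filter.Tendsto (fun n => mnorm (V n)) Filter.atTop Filter.atTop) :
    ∃ ξ K : ℝ, ∃ m : ℕ, 0 ≤ K ∧ ∀ f g k : ℝ, f + g * ξ + k * ξ ^ 2 = 0 → ∀ n, m ≤ n →
      |f * (V n * M n) 0 0 + g * (V n * M n) 0 1 + k * (V n * M n) 1 1| ≤
        K * (|f| + |g| + |k|) / mnorm (V n) := by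
  obtain ⟨α, β, δ, K, m, hK, hsum, hprod, hform⟩ :=
    h.exists_linear_form_bound hc hν0 hC hν hlow hlim
  have hα : α ≠ 0 := by
    intro h0
    have hβ : β = 0 := by
      rw [h0, zero_mul, eq_comm] at hprod
      exact pow_eq_zero_iff two_ne_zero |>.mp hprod
    have h1 := h.int_form_eq_zero hlim (f := 1) (g := 0) (k := 0) (m := m)
      (T := K * (|1| + |0| + |0|)) fun n hn => by
        simpa using hform 1 0 0 (by simp [h0]) n hn
    exact one_ne_zero h1.1
  refine ⟨β / α, K, m, hK, fun f g k hfgk => hform f g k ?_⟩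
  have e1 : δ = α * (β / α) ^ 2 := by
    field_simp
    linarith
  have e2 : β = α * (β / α) := by field_simp
  rw [e1]
  nth_rewrite 1 [e2]
  linear_combination α * hfgk

end SymmFib

/-- A sequence bounded by `K * g` from some point on is bounded by a multiple of `g` throughout. -/
lemma exists_forall_le_mul {f g : ℕ → ℝ} {K : ℝ} {m : ℕ} (hg : ∀ n, 0 < g n)
    (hf : ∀ n, m ≤ n → f n ≤ K * g n) : ∃ K', 0 < K' ∧ ∀ n, f n ≤ K' * g n := by
  obtain ⟨B, hB⟩ := ((Finset.range m).image fun n => f n / g n).exists_le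
  refine ⟨max (max B K) 1, by positivity, fun n => ?_⟩
  rcases lt_or_ge n m with hn | hn
  · have h1 := hB (f n / g n) (Finset.mem_image_of_mem _ (Finset.mem_range.mpr hn))
    rw [div_le_iff₀ (hg n)] at h1
    refine h1.trans (mul_le_mul_of_nonneg_right ?_ (hg n).le)
    exact (le_max_left _ _).trans (le_max_left _ _)
  · refine (hf n hn).trans (mul_le_mul_of_nonneg_right ?_ (hg n).le)
    exact (le_max_right _ _).trans (le_max_left _ _)

/-- Points of heights `X n` with `X (n + 1) ≪ X n ^ gam` and approximation errors `O(1 / X n)`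
solve the approximation problem uniformly with exponent `1 / gam`. -/
lemma exists_uniform_approximation {X : ℕ → ℝ} {x y z : ℕ → ℤ} {ξ k T b : ℝ} {m : ℕ} (hk : 0 < k)
    (hb : 0 < b) (hT : 0 ≤ T) (hX : ∀ n, 1 ≤ X n)
    (hlim : Filter.Tendsto X Filter.atTop Filter.atTop)
    (hgrow : ∀ n, X (n + 1) ≤ b * X n ^ gam)
    (hne : ∀ n, ¬(x n = 0 ∧ y n = 0 ∧ z n = 0)) (hx : ∀ n, |(x n : ℝ)| ≤ k * X n)
    (hy : ∀ n, m ≤ n → |(x n : ℝ) * ξ - y n| ≤ T / X n)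
    (hz : ∀ n, m ≤ n → |(x n : ℝ) * ξ ^ 2 - z n| ≤ T / X n) :
    ∃ c : ℝ, 0 < c ∧ ∀ Y : ℝ, 1 ≤ Y → ∃ x₀ x₁ x₂ : ℤ,
      ¬(x₀ = 0 ∧ x₁ = 0 ∧ x₂ = 0) ∧ |(x₀ : ℝ)| ≤ Y ∧
      |(x₀ : ℝ) * ξ - (x₁ : ℝ)| ≤ c * Y ^ (-1 / gam) ∧
      |(x₀ : ℝ) * ξ ^ 2 - (x₂ : ℝ)| ≤ c * Y ^ (-1 / gam) := by
  have hpos : ∀ n, 0 < X n := fun n => lt_of_lt_of_le one_pos (hX n)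
  have hg : 0 < gam := by linarith [one_lt_gam]
  set A : ℝ := (k * X m) ^ (1 / gam) with hA
  set B : ℝ := (k * b) ^ (1 / gam) with hB
  have hA0 : 0 < A := Real.rpow_pos_of_pos (mul_pos hk (hpos m)) _
  have hB0 : 0 < B := Real.rpow_pos_of_pos (mul_pos hk hb) _
  refine ⟨A + T * B, by positivity, fun Y hY => ?_⟩
  have hY0 : 0 < Y := by linarith
  have hYg : Y ^ (-1 / gam) = (Y ^ (1 / gam))⁻¹ := by
    rw [neg_div, Real.rpow_neg hY0.le]
  have hYp : 0 < Y ^ (1 / gam) := Real.rpow_pos_of_pos hY0 _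
  rcases lt_or_ge Y (k * X m) with hlt | hge
  · refine ⟨0, 0, 1, by simp, by simpa using hY0.le, ?_, ?_⟩
    · simp only [Int.cast_zero, zero_mul, sub_zero, abs_zero]
      rw [hYg]
      positivity
    · have h1 : Y ^ (1 / gam) ≤ A := Real.rpow_le_rpow hY0.le hlt.le (by positivity)
      simp only [Int.cast_zero, zero_mul, zero_sub, Int.cast_one, abs_neg, abs_one]
      rw [hYg, ← div_eq_mul_inv, one_le_div hYp]
      nlinarith
  · have hex : ∃ j, Y < k * X (m + j) := by
      obtain ⟨n, hn, hmn⟩ := ((hlim.eventually_gt_atTop (Y / k)).and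
        (Filter.eventually_ge_atTop m)).exists
      refine ⟨n - m, ?_⟩
      rw [Nat.add_sub_cancel' hmn]
      rwa [div_lt_iff₀' hk] at hn
    classical
    obtain ⟨i, hi⟩ : ∃ i, Nat.find hex = i + 1 := by
      refine Nat.exists_eq_succ_of_ne_zero fun h0 => ?_
      have h1 := Nat.find_spec hex
      rw [h0, add_zero] at h1
      linarith
    have hup := Nat.find_spec hex
    rw [hi, ← add_assoc] at hup
    have hdown : k * X (m + i) ≤ Y := not_lt.mp (Nat.find_min hex (by omega))
    have hle : Y ^ (1 / gam) ≤ B * X (m + i) := by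
      calc Y ^ (1 / gam) ≤ (k * b * X (m + i) ^ gam) ^ (1 / gam) := by
            refine Real.rpow_le_rpow hY0.le ?_ (by positivity)
            have := mul_le_mul_of_nonneg_left (hgrow (m + i)) hk.le
            linarith
        _ = B * X (m + i) := by
            rw [Real.mul_rpow (by positivity) (Real.rpow_nonneg (hpos _).le _),
              ← Real.rpow_mul (hpos _).le, mul_one_div_cancel hg.ne', Real.rpow_one]
    have hfin : T / X (m + i) ≤ (A + T * B) * Y ^ (-1 / gam) := by
      rw [hYg, ← div_eq_mul_inv, div_le_div_iff₀ (hpos _) hYp]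
      have h1 := mul_le_mul_of_nonneg_left hle hT
      have h2 := mul_pos hA0 (hpos (m + i))
      nlinarith
    exact ⟨x (m + i), y (m + i), z (m + i), hne _, (hx _).trans hdown,
      (hy _ (by omega)).trans hfin, (hz _ (by omega)).trans hfin⟩

lemma abs_det_le_xiNorm (ξ : ℝ) (A : M2) : |(A.det : ℝ)| ≤ 2 * (mnorm A * xiNorm ξ A) := by
  have h0 : |ξ * (A 0 0 : ℝ) - (A 1 0 : ℝ)| ≤ xiNorm ξ A := le_max_left _ _
  have h1 : |ξ * (A 0 1 : ℝ) - (A 1 1 : ℝ)| ≤ xiNorm ξ A := le_max_right _ _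
  have e : (A.det : ℝ) = (A 0 1 : ℝ) * (ξ * (A 0 0 : ℝ) - (A 1 0 : ℝ)) -
      (A 0 0 : ℝ) * (ξ * (A 0 1 : ℝ) - (A 1 1 : ℝ)) := by
    rw [Matrix.det_fin_two]
    push_cast
    ring
  have m0 := mul_le_mul (abs_entry_le_mnorm A 0 1) h0 (abs_nonneg _) (mnorm_nonneg A)
  have m1 := mul_le_mul (abs_entry_le_mnorm A 0 0) h1 (abs_nonneg _) (mnorm_nonneg A)
  rw [← abs_mul] at m0 m1
  rw [e]
  refine (abs_sub _ _).trans ?_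
  linarith

lemma xiNorm_mul_le (ξ : ℝ) (A B : M2) : xiNorm ξ (A * B) ≤ 2 * (xiNorm ξ A * mnorm B) := by
  have h0 : |ξ * (A 0 0 : ℝ) - (A 1 0 : ℝ)| ≤ xiNorm ξ A := le_max_left _ _
  have h1 : |ξ * (A 0 1 : ℝ) - (A 1 1 : ℝ)| ≤ xiNorm ξ A := le_max_right _ _
  have hA : 0 ≤ xiNorm ξ A := (abs_nonneg _).trans h0
  have key : ∀ j, |ξ * ((A * B) 0 j : ℝ) - ((A * B) 1 j : ℝ)| ≤ 2 * (xiNorm ξ A * mnorm B) := by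
    intro j
    have e : ξ * ((A * B) 0 j : ℝ) - ((A * B) 1 j : ℝ) =
        (ξ * (A 0 0 : ℝ) - (A 1 0 : ℝ)) * B 0 j + (ξ * (A 0 1 : ℝ) - (A 1 1 : ℝ)) * B 1 j := by
      rw [Matrix.mul_apply, Matrix.mul_apply, Fin.sum_univ_two, Fin.sum_univ_two]
      push_cast
      ring
    have m0 := mul_le_mul h0 (abs_entry_le_mnorm B 0 j) (abs_nonneg _) hA
    have m1 := mul_le_mul h1 (abs_entry_le_mnorm B 1 j) (abs_nonneg _) hA
    rw [← abs_mul] at m0 m1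
    rw [e]
    refine (abs_add_le _ _).trans ?_
    linarith
  exact max_le (key 0) (key 1)

lemma xiNorm_le_smul (ξ : ℝ) {k : ℤ} (hk : k ≠ 0) (A : M2) : xiNorm ξ A ≤ xiNorm ξ (k • A) := by
  have h : (1 : ℝ) ≤ |(k : ℝ)| := by exact_mod_cast Int.one_le_abs hk
  have key : ∀ j, |ξ * (A 0 j : ℝ) - (A 1 j : ℝ)| ≤
      |ξ * ((k • A) 0 j : ℝ) - ((k • A) 1 j : ℝ)| := by
    intro j
    have e : ξ * ((k • A) 0 j : ℝ) - ((k • A) 1 j : ℝ) = k * (ξ * (A 0 j : ℝ) - (A 1 j : ℝ)) := by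
      simp only [Matrix.smul_apply, smul_eq_mul, Int.cast_mul]
      ring
    rw [e, abs_mul]
    exact le_mul_of_one_le_left (abs_nonneg _) h
  exact max_le_max (key 0) (key 1)

/-- A symmetrizable Fibonacci sequence with bounded determinants and quasi-multiplicative norms
determines an extremal number, which it approximates at the optimal rate. -/
lemma SymmFib.exists_isExtremal {V M : ℕ → M2} {e : ℕ → ℤ} (h : SymmFib V M e) {b c C ν : ℝ}
    (hb : 0 < b) (hc : 0 < c) (hν0 : 0 < ν) (hC : ∀ n, |((V n).det : ℝ)| ≤ C)
    (hν : ∀ n, mnorm (M n) ≤ ν)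
    (hlow : ∀ n, c * (mnorm (V (n + 1)) * mnorm (V n)) ≤ mnorm (V (n + 2)))
    (hgrow : ∀ n, mnorm (V (n + 1)) ≤ b * mnorm (V n) ^ gam)
    (hlim : Filter.Tendsto (fun n => mnorm (V n)) Filter.atTop Filter.atTop) :
    ∃ ξ, IsExtremal ξ ∧ ∃ K, 0 < K ∧ ∀ n, xiNorm ξ (V n) ≤ K * (mnorm (V n))⁻¹ := by
  obtain ⟨ξ, K, m, hK, hform⟩ := h.exists_xi hc hν0 hC hν hlow hlim
  have hpos : ∀ n, 0 < mnorm (V n) := fun n => lt_of_lt_of_le one_pos (h.one_le_mnorm n)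
  refine ⟨ξ, ⟨?_, ?_⟩, ?_⟩
  · intro a₂ a₁ a₀ hne hroot
    have hint : (a₀.num * a₁.den * a₂.den : ℤ) = 0 ∧ (a₁.num * a₀.den * a₂.den : ℤ) = 0 ∧
        (a₂.num * a₀.den * a₁.den : ℤ) = 0 := by
      refine h.int_form_eq_zero hlim fun n hn => hform _ _ _ ?_ n hn
      have d0 : (a₀.den : ℝ) ≠ 0 := by exact_mod_cast a₀.den_ne_zero
      have d1 : (a₁.den : ℝ) ≠ 0 := by exact_mod_cast a₁.den_ne_zero
      have d2 : (a₂.den : ℝ) ≠ 0 := by exact_mod_cast a₂.den_ne_zero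
      rw [Rat.cast_def a₀, Rat.cast_def a₁, Rat.cast_def a₂] at hroot
      field_simp at hroot
      push_cast
      linear_combination hroot
    apply hne
    simpa [and_assoc, and_comm, and_left_comm] using hint
  · refine exists_uniform_approximation (X := fun n => mnorm (V n))
      (x := fun n => (V n * M n) 0 0) (y := fun n => (V n * M n) 0 1)
      (z := fun n => (V n * M n) 1 1) (k := 2 * ν) (m := m)
      (T := K * (|ξ| + 1) + K * (|ξ ^ 2| + 1)) (by positivity) hb (by positivity)
      h.one_le_mnorm hlim hgrow ?_ ?_ ?_ ?_
    · rintro n ⟨h0, h1, h2⟩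
      have hdet := Matrix.det_mul (V n) (M n)
      rw [Matrix.det_fin_two, h.symm, h0, h1, h2] at hdet
      exact mul_ne_zero (h.det_ne n) (h.det_mult_ne n) (by simpa using hdet.symm)
    · exact fun n => (abs_entry_le_mnorm _ 0 0).trans (SymmFib.mnorm_symm_le hν n)
    · intro n hn
      have h1 := hform ξ (-1) 0 (by ring) n hn
      have e1 : ξ * ((V n * M n) 0 0 : ℝ) + -1 * (V n * M n) 0 1 + 0 * (V n * M n) 1 1 =
        ((V n * M n) 0 0 : ℝ) * ξ - (V n * M n) 0 1 := by ring
      rw [e1, abs_neg, abs_one, abs_zero, add_zero] at h1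
      refine h1.trans (div_le_div_of_nonneg_right ?_ (hpos n).le)
      have : 0 ≤ K * (|ξ ^ 2| + 1) := by positivity
      linarith
    · intro n hn
      have h1 := hform (ξ ^ 2) 0 (-1) (by ring) n hn
      have e1 : ξ ^ 2 * ((V n * M n) 0 0 : ℝ) + 0 * (V n * M n) 0 1 + -1 * (V n * M n) 1 1 =
        ((V n * M n) 0 0 : ℝ) * ξ ^ 2 - (V n * M n) 1 1 := by ring
      rw [e1, abs_neg, abs_one, abs_zero, add_zero] at h1
      refine h1.trans (div_le_div_of_nonneg_right ?_ (hpos n).le)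
      have : 0 ≤ K * (|ξ| + 1) := by positivity
      linarith
  · refine exists_forall_le_mul (m := m) (K := 2 * (K * (|ξ| + 1) * ν))
      (fun n => inv_pos.mpr (hpos n)) fun n hn => ?_
    have hx : xiNorm ξ (V n * M n) ≤ K * (|ξ| + 1) / mnorm (V n) := by
      refine max_le ?_ ?_
      · have h1 := hform ξ (-1) 0 (by ring) n hn
        rw [abs_neg, abs_one, abs_zero, add_zero] at h1
        rw [h.symm]
        refine (le_of_eq ?_).trans h1
        congr 1
        ring
      · have h1 := hform 0 ξ (-1) (by ring) n hn
        rw [abs_neg, abs_one, abs_zero, zero_add] at h1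
        refine (le_of_eq ?_).trans h1
        congr 1
        ring
    have h2 := xiNorm_le_smul ξ (h.det_mult_ne n) (V n)
    rw [SymmFib.det_smul_eq] at h2
    calc xiNorm ξ (V n) ≤ 2 * (xiNorm ξ (V n * M n) * mnorm (M n).adjugate) :=
          h2.trans (xiNorm_mul_le _ _ _)
      _ ≤ 2 * (K * (|ξ| + 1) / mnorm (V n) * ν) := by
          have h3 := (mnorm_adjugate_le (M n)).trans (hν n)
          have h4 := hpos n
          have h5 := mnorm_nonneg (M n).adjugate
          gcongr
      _ = _ := by ring

lemma skew_entries_ne {N : M2} (h : N ≠ Nᵀ) : N 0 1 ≠ N 1 0 := by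
  intro h0
  apply h
  ext i j
  fin_cases i <;> fin_cases j <;> simp [h0]

/-- An admissible Fibonacci sequence in `𝒫`, reindexed from `0`, is symmetrizable. -/
lemma IsFibP.exists_symmFib {W : ℕ → M2} (hFib : IsFibP W) (hAdm : AdmissibleFib W) :
    ∃ (M : ℕ → M2) (e : ℕ → ℤ) (ν : ℝ), 0 < ν ∧ SymmFib (fun n => W (n + 1)) M e ∧
      ∀ n, mnorm (M n) ≤ ν := by
  obtain ⟨N, ⟨-, hN⟩, hskew, -, hsymm⟩ := hAdm
  have hne := skew_entries_ne hskew
  have hcases : ∀ n, (if (n + 1) % 2 = 1 then Nᵀ else N) = Nᵀ ∨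
      (if (n + 1) % 2 = 1 then Nᵀ else N) = N := fun n => ite_eq_or_eq _ _ _
  refine ⟨fun n => if (n + 1) % 2 = 1 then Nᵀ else N,
    fun n => (content (W (n + 2) * W (n + 1)) : ℤ), mnorm N,
    lt_of_lt_of_le one_pos (one_le_mnorm hN), ⟨?_, ?_, ?_, ?_, ?_, ?_, ?_⟩, ?_⟩
  · intro n
    have hdet : (W (n + 2) * W (n + 1)).det ≠ 0 := by
      rw [Matrix.det_mul]
      exact mul_ne_zero (hFib.1 _ (by omega)).2 (hFib.1 _ (by omega)).2
    exact_mod_cast content_ne_zero hdet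
  · intro n
    simp only [hFib.2 (n + 1) (by omega), pmul]
    exact content_smul_red _
  · intro n
    have : (n + 2 + 1) % 2 = (n + 1) % 2 := by omega
    simp only [this]
  · exact fun n => (hFib.1 _ (by omega)).2
  · intro n
    rcases hcases n with h | h <;> simp only [h]
    · rwa [Matrix.det_transpose]
    · exact hN
  · intro n
    rcases hcases n with h | h <;> simp only [h]
    · exact hne.symm
    · exact hne
  · exact fun n => ((hsymm (n + 1) (by omega)).apply 0 1)
  · intro n
    rcases hcases n with h | h <;> simp only [h]
    · exact mnorm_transpose_le N
    · exact le_rfl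

/-- Any unbounded admissible Fibonacci sequence in 𝒫 with ‖W_{i+2}‖ ≫ ‖W_{i+1}‖‖W_i‖ and
|det W_i| ≪ 1 is associated to some extremal real number ξ. -/
theorem stmt2 (W : ℕ → M2) (hFib : IsFibP W) (hUnb : UnboundedSeq W) (hAdm : AdmissibleFib W)
    (c C : ℝ) (hc : 0 < c) (hC : 0 < C)
    (hgrow : ∀ i, 1 ≤ i → c * (mnorm (W (i + 1)) * mnorm (W i)) ≤ mnorm (W (i + 2)))
    (hdet : ∀ i, 1 ≤ i → |((W i).det : ℝ)| ≤ C) :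
    ∃ ξ : ℝ, IsExtremal ξ ∧ IsAssociated ξ W := by
  obtain ⟨M, e, ν, hν0, hS, hν⟩ := hFib.exists_symmFib hAdm
  have hlow : ∀ n, c * (mnorm (W (n + 1 + 1)) * mnorm (W (n + 1))) ≤ mnorm (W (n + 2 + 1)) :=
    fun n => hgrow (n + 1) (by omega)
  obtain ⟨D, -, hD⟩ := exists_rpow_gam_bounds hc hS.one_le_mnorm hlow hS.mnorm_recur_le
  have hlim := tendsto_atTop_of_rpow_gam_le hS.one_le_mnorm (fun n => (hD n).1) fun T => by
    obtain ⟨i, hi, hT⟩ := hUnb T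
    exact ⟨i - 1, by simpa only [Nat.sub_add_cancel hi] using hT⟩
  obtain ⟨ξ, hξ, K, hK, hxi⟩ := hS.exists_isExtremal (Real.exp_pos D) hc hν0
    (fun n => hdet (n + 1) (by omega)) hν hlow (fun n => (hD n).2) hlim
  refine ⟨ξ, hξ, hFib, hUnb, hAdm, Real.exp (-D), Real.exp D, 1 / 2, K, 1, C, Real.exp_pos _,
    Real.exp_pos _, by norm_num, hK, one_pos, hC, fun i hi => ?_⟩
  obtain ⟨n, rfl⟩ : ∃ n, i = n + 1 := ⟨i - 1, by omega⟩
  have hd : (1 : ℝ) ≤ |((W (n + 1)).det : ℝ)| := by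
    exact_mod_cast Int.one_le_abs (hS.det_ne n)
  refine ⟨(hD n).1, (hD n).2, ?_, hxi n, hd, hdet _ hi⟩
  have h1 := hd.trans (abs_det_le_xiNorm ξ (W (n + 1)))
  have h2 : 0 < mnorm (W (n + 1)) := lt_of_lt_of_le one_pos (hS.one_le_mnorm n)
  rw [← div_eq_mul_inv, div_le_iff₀ h2]
  linarith
end

section
/- Let w₁ and w₂ be words over the alphabet of positive integers with w₁w₂ ≠ w₂w₁, and let (w_i)_{i≥1} be the Fibonacci sequence of words they generate. Then the infinite limit word w_∞ = lim_{i→∞} w_i is not ultimately periodic. -/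
open Matrix

/-- The word `v` occurs in the infinite word `b₁b₂b₃…` right after its first `a` letters. -/
def OccursAt {α : Type} (b : ℕ → α) (a : ℕ) (v : List α) : Prop :=
  ∀ j, (h : j < v.length) → v[j] = b (a + j + 1)

theorem OccursAt.of_append {α : Type} {b : ℕ → α} {a : ℕ} {s v t : List α}
    (h : OccursAt b a (s ++ v ++ t)) : OccursAt b (a + s.length) v := by
  intro j hj
  have := h (s.length + j) (by simp; omega)
  rw [List.getElem_append_left (by simp; omega), List.getElem_append_right (by omega)] at this
  simpa [Nat.add_assoc] using this

theorem OccursAt.eq_of_shift {α : Type} {b : ℕ → α} {a q : ℕ} {u v : List α}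
    (hu : OccursAt b a u) (hv : OccursAt b (a + q) v) (hlen : u.length = v.length)
    (hb : ∀ n, a < n → b (n + q) = b n) : u = v := by
  refine List.ext_getElem hlen fun j h₁ h₂ => ?_
  rw [hu j h₁, hv j h₂, ← hb (a + j + 1) (by omega)]
  congr 1
  omega

/-- If a square `xx` occurs in a `p`-periodic tail of `b` and `x` has length at least `p`,
then the length of `x` is a period of `b` from that occurrence on. -/
theorem OccursAt.period_of_square {α : Type} {b : ℕ → α} {a p : ℕ} {x : List α}
    (hx : OccursAt b a x) (hx' : OccursAt b (a + x.length) x) (hp : 1 ≤ p) (hpx : p ≤ x.length)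
    (hb : ∀ n, a < n → b (n + p) = b n) : ∀ n, a < n → b (n + x.length) = b n := by
  intro n
  induction n using Nat.strong_induction_on with
  | _ n ih =>
    intro hn
    by_cases hlt : n ≤ a + x.length
    · obtain ⟨j, rfl⟩ := Nat.exists_eq_add_of_lt hn
      rw [← hx j (by omega), hx' j (by omega)]
      congr 1
      omega
    · have h₁ := hb (n - p) (by omega)
      have h₂ := hb (n - p + x.length) (by omega)
      have h₃ := ih (n - p) (by omega) (by omega)
      rw [show n - p + p = n by omega] at h₁
      rw [show n - p + x.length + p = n + x.length by omega] at h₂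
      rw [h₂, h₃, h₁]

theorem FibWordSeq.append_ne {α : Type} {w : ℕ → List α} (hfib : FibWordSeq w)
    (hnc : w 1 ++ w 2 ≠ w 2 ++ w 1) {k : ℕ} (hk : 1 ≤ k) :
    w k ++ w (k + 1) ≠ w (k + 1) ++ w k := by
  induction k, hk using Nat.le_induction with
  | base => exact hnc
  | succ k hk ih =>
    rw [hfib k hk, List.append_assoc]
    exact fun h => ih (List.append_cancel_left h).symm

/-- The limit of a Fibonacci sequence of words over the positive integers starting with two
non-commuting words is not ultimately periodic. -/
theorem stmt4 (w : ℕ → List ℕ+) (hfib : FibWordSeq w) (hnc : w 1 ++ w 2 ≠ w 2 ++ w 1)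
    (b : ℕ → ℕ+) (hb : IsLimitWord w b) :
    ¬ ∃ p : ℕ, 1 ≤ p ∧ ∃ n₀ : ℕ, 1 ≤ n₀ ∧ ∀ n, n₀ ≤ n → b (n + p) = b n := by
  rintro ⟨p, hp, n₀, -, hper⟩
  obtain ⟨k, hk, hlen⟩ := hb.1 (max p n₀)
  obtain ⟨k, rfl⟩ : ∃ m, k = m + 1 := ⟨k - 1, by omega⟩
  have hne := hfib.append_ne hnc (k := k) (by omega)
  have hocc : OccursAt b 0 (w (k + 5)) := fun j h => by
    simpa using hb.2 (k + 5) (by omega) j h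
  rw [hfib (k + 3) (by omega), hfib (k + 2) (by omega), hfib (k + 1) (by omega),
    hfib k (by omega)] at hocc
  generalize w (k + 1) = x at *
  generalize w k = y at *
  have h₁ : OccursAt b (x ++ y).length (x ++ x ++ y) := by
    have : OccursAt b 0 ((x ++ y) ++ (x ++ x ++ y) ++ (x ++ y ++ x)) := by simpa using hocc
    simpa only [Nat.zero_add] using this.of_append
  have h₂ : OccursAt b ((x ++ y).length + x.length) (x ++ y ++ x) := by
    have : OccursAt b 0 ((x ++ y ++ x) ++ (x ++ y ++ x) ++ (y ++ x)) := by simpa using hocc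
    simpa only [Nat.zero_add, List.length_append] using this.of_append
  have hx : OccursAt b (x ++ y).length x :=
    OccursAt.of_append (s := []) (t := x ++ y) (by simpa using h₁)
  have hx' : OccursAt b ((x ++ y).length + x.length) x :=
    OccursAt.of_append (s := []) (t := y ++ x) (by simpa using h₂)
  have hxy : n₀ ≤ (x ++ y).length := by simp; omega
  have hshift := hx.period_of_square hx' hp (by omega) fun n hn => hper n (by omega)
  have heq := h₁.eq_of_shift h₂ (by simp; omega) hshift
  rw [List.append_assoc, List.append_assoc] at heq
  exact hne (List.append_cancel_left heq).symm
end
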